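/- Let Σ be a type, let x₁, x₂, x₃, y₁, y₂, y₃ be words over Σ, and let n be a natural number with n > 0. Suppose |del(x₁, y₁)| ≤ n and |del(x₁ ++ x₂^{3n}, y₁ ++ y₂^{3n})| ≤ n, where x₂^{3n} denotes the 3n-fold concatenation of x₂ with itself. Then del(x₁ ++ x₂^{3n} ++ x₃, y₁ ++ y₂^{3n} ++ y₃) = del(x₁ ++ x₃, y₁ ++ y₃). -/

import Mathlib

/-- The canonical map sending a word to the product of the free-group
generators of its letters. -/
def iota {α : Type*} (w : List α) : FreeGroup α :=
  (w.map FreeGroup.of).prod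

/-- The delay between two words `u` and `v`. -/
def del {α : Type*} (u v : List α) : FreeGroup α :=
  (iota u)⁻¹ * iota v

/-- The `i`-fold concatenation of a word with itself. -/
def wpow {α : Type*} (w : List α) (i : ℕ) : List α :=
  (List.replicate i w).flatten

theorem iota_append {α : Type*} (u v : List α) : iota (u ++ v) = iota u * iota v := by
  simp [iota]

theorem iota_wpow {α : Type*} (u : List α) (k : ℕ) : iota (wpow u k) = iota u ^ k := by
  induction k with
  | zero => simp [wpow, iota]
  | succ k ih =>
    have : wpow u (k+1) = u ++ wpow u k := by simp [wpow, List.replicate_succ]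
    rw [this, iota_append, ih, pow_succ']

theorem iota_mk {α : Type*} (u : List α) : iota u = FreeGroup.mk (u.map (fun a => (a, true))) := by
  induction u with
  | nil => rfl
  | cons a u ih =>
    have : iota (a :: u) = FreeGroup.of a * iota u := by simp [iota]
    rw [this, ih]; rfl

theorem del_cancel {α : Type*} (w u v : List α) : del (w ++ u) (w ++ v) = del u v := by
  simp only [del, iota_append]; group

theorem isReduced_map {α : Type*} (u : List α) (e : Bool) :
    FreeGroup.IsReduced (u.map (fun a => (a, e))) := by
  unfold FreeGroup.IsReduced
  rw [List.isChain_map]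
  apply List.Pairwise.isChain
  exact List.pairwise_of_forall (fun _ _ _ => rfl)

theorem invRev_map {α : Type*} (u : List α) :
    FreeGroup.invRev (u.map (fun a => (a, true))) = u.reverse.map (fun a => (a, false)) := by
  simp [FreeGroup.invRev, Function.comp_def]

theorem del_norm {α : Type*} [DecidableEq α] (a b : List α)
    (h : ∀ c s d t, a = c :: s → b = d :: t → c ≠ d) :
    FreeGroup.norm (del a b) = a.length + b.length := by
  have e : del a b = FreeGroup.mk (a.reverse.map (fun a => (a, false)) ++
      b.map (fun a => (a, true))) := by
    rw [del, iota_mk, iota_mk, FreeGroup.inv_mk, FreeGroup.mul_mk, invRev_map]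
  have r : FreeGroup.IsReduced (a.reverse.map (fun a => (a, false)) ++
      b.map (fun a => (a, true))) := by
    unfold FreeGroup.IsReduced
    rw [List.isChain_append]
    refine ⟨isReduced_map _ _, isReduced_map _ _, ?_⟩
    intro x hx y hy hxy
    cases a with
    | nil => simp at hx
    | cons c s =>
      cases b with
      | nil => simp at hy
      | cons d t =>
        simp at hx hy
        subst hx hy
        exact absurd hxy (h c s d t rfl rfl)
  rw [e, FreeGroup.norm, FreeGroup.toWord_mk, r.reduce_eq]
  simp

theorem del_decomp {α : Type*} [DecidableEq α] (x y : List α) :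
    ∃ w a b, x = w ++ a ∧ y = w ++ b ∧ FreeGroup.norm (del x y) = a.length + b.length ∧
      ∀ c s d t, a = c :: s → b = d :: t → c ≠ d := by
  induction x generalizing y with
  | nil => exact ⟨[], [], y, rfl, rfl, del_norm _ _ (by simp), by simp⟩
  | cons c s ih =>
    cases y with
    | nil => exact ⟨[], c :: s, [], rfl, rfl, del_norm _ _ (by simp), by simp⟩
    | cons d t =>
      by_cases hcd : c = d
      · subst hcd
        obtain ⟨w, a, b, h1, h2, h3, h4⟩ := ih t
        refine ⟨c :: w, a, b, by simp [h1], by simp [h2], ?_, h4⟩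
        rw [← h3]
        exact congrArg _ (del_cancel [c] s t)
      · have : ∀ c' s' d' t', c :: s = c' :: s' → d :: t = d' :: t' → c' ≠ d' := by
          intro c' s' d' t' h1 h2
          simp at h1 h2
          rw [← h1.1, ← h2.1]; exact hcd
        exact ⟨[], c :: s, d :: t, rfl, rfl, del_norm _ _ this, this⟩

theorem length_wpow {α : Type*} (u : List α) (k : ℕ) : (wpow u k).length = k * u.length := by
  simp [wpow]

theorem wpow_succ {α : Type*} (u : List α) (k : ℕ) : wpow u (k+1) = u ++ wpow u k := by
  simp [wpow, List.replicate_succ]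

theorem wpow_succ2 {α : Type*} (u : List α) (k : ℕ) : wpow u (k+1) = wpow u k ++ u := by
  simp [wpow, List.replicate_succ']

theorem core_comm {α : Type*} [DecidableEq α] (X Y v : List α) (n : ℕ) (hn : 0 < n)
    (hl : X.length = Y.length) (hv : v.length ≤ n)
    (h : FreeGroup.norm (del (wpow X (3*n)) (v ++ wpow Y (3*n))) ≤ n) :
    X ++ v = v ++ Y := by
  rcases Nat.eq_zero_or_pos X.length with h0 | hp
  · have hY : Y = [] := List.length_eq_zero_iff.1 (hl ▸ h0)
    have hX : X = [] := List.length_eq_zero_iff.1 h0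
    simp [hX, hY]
  obtain ⟨w, a, b, h1, h2, h3, -⟩ := del_decomp (wpow X (3*n)) (v ++ wpow Y (3*n))
  have l1 := congrArg List.length h1
  rw [length_wpow, List.length_append] at l1
  have hlen : (v ++ Y).length ≤ w.length := by
    rw [List.length_append, ← hl]
    nlinarith
  have p1 : v ++ Y <+: v ++ wpow Y (3*n) := by
    obtain ⟨m, rfl⟩ : ∃ m, n = m + 1 := ⟨n - 1, by omega⟩
    rw [show 3 * (m+1) = (3*m+2)+1 by ring, wpow_succ, ← List.append_assoc]
    exact List.prefix_append _ _
  have p2 : w <+: v ++ wpow Y (3*n) := h2 ▸ List.prefix_append _ _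
  have p3 : v ++ Y <+: wpow X (3*n) :=
    (List.prefix_of_prefix_length_le p1 p2 hlen).trans (h1 ▸ List.prefix_append _ _)
  have p4 : v ++ Y <+: wpow X (3*n+1) := p3.trans (wpow_succ2 X _ ▸ List.prefix_append _ _)
  have p5 : X ++ v <+: wpow X (3*n+1) := by
    rw [wpow_succ, List.prefix_append_right_inj]
    exact (List.prefix_append v Y).trans p3
  exact (List.prefix_of_prefix_length_le p5 p4 (by simp; omega)).eq_of_length (by simp; omega)

theorem core_del {α : Type*} [DecidableEq α] (X Y v : List α) (n : ℕ) (hn : 0 < n)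
    (hl : X.length = Y.length) (hv : v.length ≤ n)
    (h : FreeGroup.norm (del (wpow X (3*n)) (v ++ wpow Y (3*n))) ≤ n) :
    (iota X ^ (3*n))⁻¹ * iota v * iota Y ^ (3*n) = iota v := by
  have e := congrArg iota (core_comm X Y v n hn hl hv h)
  rw [iota_append, iota_append] at e
  have : SemiconjBy (iota v) (iota Y) (iota X) := e.symm
  have := (this.pow_right (3*n)).eq
  rw [mul_assoc, this, inv_mul_cancel_left]

theorem norm_del_comm {α : Type*} [DecidableEq α] (x y : List α) :
    FreeGroup.norm (del x y) = FreeGroup.norm (del y x) := by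
  rw [← FreeGroup.norm_inv_eq]; simp [del]

theorem delay_stable_when_iterating {α : Type*} [DecidableEq α]
    (x₁ x₂ x₃ y₁ y₂ y₃ : List α) (n : ℕ) (hn : 0 < n)
    (h₁ : FreeGroup.norm (del x₁ y₁) ≤ n)
    (h₂ : FreeGroup.norm (del (x₁ ++ wpow x₂ (3 * n)) (y₁ ++ wpow y₂ (3 * n))) ≤ n) :
    del (x₁ ++ wpow x₂ (3 * n) ++ x₃) (y₁ ++ wpow y₂ (3 * n) ++ y₃) =
      del (x₁ ++ x₃) (y₁ ++ y₃) := by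
  obtain ⟨w, u, v, rfl, rfl, hd, hne⟩ := del_decomp x₁ y₁
  rw [hd] at h₁
  simp only [List.append_assoc, del_cancel] at h₂ ⊢
  obtain ⟨w', a, b, e1, e2, hd', -⟩ := del_decomp (u ++ wpow x₂ (3 * n)) (v ++ wpow y₂ (3 * n))
  rw [hd'] at h₂
  have l1 := congrArg List.length e1
  have l2 := congrArg List.length e2
  simp only [List.length_append, length_wpow] at l1 l2
  have hl : x₂.length = y₂.length := by
    rcases lt_trichotomy x₂.length y₂.length with h | h | h
    · nlinarith
    · exact h
    · nlinarith
  suffices H : (iota x₂ ^ (3*n))⁻¹ * ((iota u)⁻¹ * iota v) * iota y₂ ^ (3*n)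
      = (iota u)⁻¹ * iota v by
    simp only [del, iota_append, iota_wpow, mul_inv_rev]
    calc _ = (iota x₃)⁻¹ * ((iota x₂ ^ (3*n))⁻¹ * ((iota u)⁻¹ * iota v) * iota y₂ ^ (3*n))
          * iota y₃ := by simp only [mul_assoc]
      _ = _ := by rw [H]; simp only [mul_assoc]
  rcases Nat.eq_zero_or_pos x₂.length with h0 | hp
  · have hY : y₂ = [] := List.length_eq_zero_iff.1 (hl ▸ h0)
    have hX : x₂ = [] := List.length_eq_zero_iff.1 h0
    simp [hX, hY, iota]
  rw [← hd'] at h₂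
  cases u with
  | nil =>
    have := core_del x₂ y₂ v n hn hl (by simp at h₁; exact h₁) h₂
    simpa [iota] using this
  | cons c s =>
    cases v with
    | nil =>
      rw [norm_del_comm] at h₂
      have := core_del y₂ x₂ (c :: s) n hn hl.symm (by simpa using h₁) h₂
      have := congrArg (·⁻¹) this
      have e : iota ([] : List α) = 1 := rfl
      simpa [e, mul_assoc] using this
    | cons d t =>
      exfalso
      have hcd := hne c s d t rfl rfl
      rw [del_norm] at h₂
      · simp only [List.length_append, length_wpow, List.length_cons] at h₂
        nlinarith
      · intro c' s' d' t' h1 h2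
        simp at h1 h2
        rw [← h1.1, ← h2.1]; exact hcd
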